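/- Every finite-dimensional complex simple Lie algebra L admits a co-split structure: there exists a linear map δ : L → L ⊗ L making (L, δ) a Lie coalgebra such that the composition of the bracket map L ⊗ L → L with δ equals the identity on L. -/

import Mathlib

open TensorProduct

/-- The bracket of `L` as a bilinear map. -/
noncomputable abbrev brBilin (K : Type*) [Field K] (L : Type*) [LieRing L] [LieAlgebra K L] :
    L →ₗ[K] L →ₗ[K] L :=
  LinearMap.mk₂ K (fun x y => ⁅x, y⁆) add_lie smul_lie lie_add lie_smul

/-- The flip map `τ` on `L ⊗ L`. -/
noncomputable abbrev tauL (K : Type*) [Field K] (L : Type*) [AddCommGroup L] [Module K L] :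
    L ⊗[K] L →ₗ[K] L ⊗[K] L :=
  (TensorProduct.comm K L L).toLinearMap

/-- The cyclic permutation `ξ : u ⊗ v ⊗ w ↦ v ⊗ w ⊗ u` (right-associated tensors). -/
noncomputable abbrev xiL (K : Type*) [Field K] (L : Type*) [AddCommGroup L] [Module K L] :
    L ⊗[K] (L ⊗[K] L) →ₗ[K] L ⊗[K] (L ⊗[K] L) :=
  ((TensorProduct.leftComm K L L L).trans
    (TensorProduct.congr (LinearEquiv.refl K L) (TensorProduct.comm K L L))).toLinearMap

section CoSplit

variable {K L : Type*} [Field K]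

/-- The functional `u ⊗ v ↦ f u * g v`. -/
noncomputable def tensorDual {M N : Type*} [AddCommGroup M] [Module K M] [AddCommGroup N]
    [Module K N] (f : M →ₗ[K] K) (g : N →ₗ[K] K) : M ⊗[K] N →ₗ[K] K :=
  LinearMap.mul' K K ∘ₗ TensorProduct.map f g

@[simp]
lemma tensorDual_tmul {M N : Type*} [AddCommGroup M] [Module K M] [AddCommGroup N]
    [Module K N] (f : M →ₗ[K] K) (g : N →ₗ[K] K) (u : M) (v : N) :
    tensorDual f g (u ⊗ₜ v) = f u * g v := by
  simp [tensorDual]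

lemma Module.Basis.tensorProduct_repr_eq_tensorDual {ι κ M N : Type*} [AddCommGroup M]
    [Module K M] [AddCommGroup N] [Module K N] (b : Module.Basis ι K M) (c : Module.Basis κ K N)
    (t : M ⊗[K] N) (i : ι) (j : κ) :
    (b.tensorProduct c).repr t (i, j) = tensorDual (b.coord i) (c.coord j) t := by
  induction t with
  | zero => simp
  | tmul u v => simp [mul_comm]
  | add s t hs ht => simp only [map_add, Finsupp.add_apply, hs, ht]

lemma Module.Basis.tensorProduct_coord {ι κ M N : Type*} [AddCommGroup M]
    [Module K M] [AddCommGroup N] [Module K N] (b : Module.Basis ι K M) (c : Module.Basis κ K N)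
    (i : ι) (j : κ) :
    (b.tensorProduct c).coord (i, j) = tensorDual (b.coord i) (c.coord j) :=
  LinearMap.ext fun t => b.tensorProduct_repr_eq_tensorDual c t i j

variable [AddCommGroup L] [Module K L]

lemma tensorDual_tauL (f g : L →ₗ[K] K) (t : L ⊗[K] L) :
    tensorDual f g (tauL K L t) = tensorDual g f t := by
  induction t with
  | zero => simp
  | tmul u v => simp [mul_comm]
  | add s t hs ht => simp only [map_add, hs, ht]

lemma tensorDual_xiL (f g h : L →ₗ[K] K) (t : L ⊗[K] (L ⊗[K] L)) :
    tensorDual f (tensorDual g h) (xiL K L t) = tensorDual h (tensorDual f g) t := by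
  have : tensorDual f (tensorDual g h) ∘ₗ xiL K L = tensorDual h (tensorDual f g) := by
    ext u v w
    simp only [LinearMap.coe_comp, Function.comp_apply, TensorProduct.AlgebraTensorModule.curry_apply,
      LinearMap.restrictScalars_self, TensorProduct.curry_apply, LinearEquiv.coe_coe,
      LinearEquiv.trans_apply, TensorProduct.leftComm_tmul, TensorProduct.congr_tmul,
      LinearEquiv.refl_apply, TensorProduct.comm_tmul, tensorDual_tmul]
    ring
  exact LinearMap.congr_fun this t

lemma tensorDual_lTensor {δ : L →ₗ[K] L ⊗[K] L} {f g h p : L →ₗ[K] K}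
    (hp : ∀ x, tensorDual g h (δ x) = p x) (t : L ⊗[K] L) :
    tensorDual f (tensorDual g h) (LinearMap.lTensor L δ t) = tensorDual f p t := by
  induction t with
  | zero => simp
  | tmul u v => simp [hp]
  | add s t hs ht => simp only [map_add, hs, ht]

variable [FiniteDimensional K L] {B : LinearMap.BilinForm K L}

lemma exists_coord_eq_of_nondegenerate {ι : Type*} (hB : B.Nondegenerate)
    (b : Module.Basis ι K L) (i : ι) : ∃ y, b.coord i = B y :=
  ⟨(B.toDual hB).symm (b.coord i), by
    ext v; exact (LinearMap.BilinForm.apply_toDual_symm_apply (hB := hB) (b.coord i) v).symm⟩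

lemma eq_zero_of_tensorDual_eq_zero (hB : B.Nondegenerate) {t : L ⊗[K] L}
    (h : ∀ y z, tensorDual (B y) (B z) t = 0) : t = 0 := by
  let b := Module.finBasis K L
  refine (b.tensorProduct b).ext_elem fun ⟨i, j⟩ => ?_
  obtain ⟨y, hy⟩ := exists_coord_eq_of_nondegenerate hB b i
  obtain ⟨z, hz⟩ := exists_coord_eq_of_nondegenerate hB b j
  rw [b.tensorProduct_repr_eq_tensorDual b, hy, hz, h, map_zero, Finsupp.zero_apply]

lemma eq_zero_of_tensorDual_tensorDual_eq_zero (hB : B.Nondegenerate)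
    {t : L ⊗[K] (L ⊗[K] L)}
    (h : ∀ u v w, tensorDual (B u) (tensorDual (B v) (B w)) t = 0) : t = 0 := by
  let b := Module.finBasis K L
  refine (b.tensorProduct (b.tensorProduct b)).ext_elem fun ⟨i, j, k⟩ => ?_
  obtain ⟨u, hu⟩ := exists_coord_eq_of_nondegenerate hB b i
  obtain ⟨v, hv⟩ := exists_coord_eq_of_nondegenerate hB b j
  obtain ⟨w, hw⟩ := exists_coord_eq_of_nondegenerate hB b k
  rw [b.tensorProduct_repr_eq_tensorDual (b.tensorProduct b), b.tensorProduct_coord b,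
    hu, hv, hw, h, map_zero, Finsupp.zero_apply]

end CoSplit

section Killing

variable {K L : Type*} [Field K] [LieRing L] [LieAlgebra K L]

/-- The map `x ↦ ∑ i, ⁅x, b i⁆ ⊗ c i`. -/
noncomputable def casimirCobracket {ι : Type*} [Fintype ι] (b c : ι → L) : L →ₗ[K] L ⊗[K] L :=
  ∑ i, (TensorProduct.mk K L L).flip (c i) ∘ₗ (brBilin K L).flip (b i)

lemma casimirCobracket_apply {ι : Type*} [Fintype ι] (b c : ι → L) (x : L) :
    casimirCobracket (K := K) b c x = ∑ i, ⁅x, b i⁆ ⊗ₜ[K] c i := by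
  simp [casimirCobracket]

variable {ι : Type*} [Fintype ι] (b : Module.Basis ι K L) {c : ι → L}

lemma tensorDual_casimirCobracket (hc : ∀ i, b.coord i = killingForm K L (c i)) (x y z : L) :
    tensorDual (killingForm K L y) (killingForm K L z) (casimirCobracket b c x) =
      - killingForm K L ⁅y, z⁆ x := by
  have hz : z = ∑ i, killingForm K L (c i) z • b i := by
    simp_rw [← hc, Module.Basis.coord_apply, b.sum_repr]
  have h : ∑ i, killingForm K L y ⁅x, b i⁆ * killingForm K L z (c i) =
      killingForm K L y ⁅x, z⁆ := by
    conv_rhs => rw [hz]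
    simp only [lie_sum, lie_smul, map_sum, map_smul, smul_eq_mul]
    exact Finset.sum_congr rfl fun i _ => by
      rw [mul_comm, LieModule.traceForm_comm K L L z]
  rw [casimirCobracket_apply, map_sum]
  simp only [tensorDual_tmul]
  rw [h, LieModule.traceForm_apply_lie_apply, ← lie_skew x z, map_neg]

lemma lift_brBilin_casimirCobracket [FiniteDimensional K L] [LieAlgebra.IsKilling K L]
    (hc : ∀ i, b.coord i = killingForm K L (c i)) (x : L) :
    TensorProduct.lift (brBilin K L) (casimirCobracket b c x) = x := by
  classical
  rw [← sub_eq_zero]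
  refine (LieAlgebra.IsKilling.killingForm_nondegenerate K L).1 _ fun y => ?_
  rw [map_sub, LinearMap.sub_apply, sub_eq_zero, casimirCobracket_apply,
    LieModule.traceForm_comm K L L x, killingForm_apply_apply K L y x, LinearMap.trace_eq_matrix_trace K b,
    Matrix.trace]
  simp only [map_sum, LinearMap.sum_apply, TensorProduct.lift.tmul, LinearMap.mk₂_apply]
  refine Finset.sum_congr rfl fun i _ => ?_
  rw [Matrix.diag_apply, LinearMap.toMatrix_apply, ← b.coord_apply, hc, LinearMap.comp_apply,
    LieAlgebra.ad_apply, LieAlgebra.ad_apply, LieModule.traceForm_comm,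
    ← LieModule.traceForm_apply_lie_apply, LieModule.traceForm_comm]

end Killing

/-- every finite dimensional complex simple Lie algebra admits a
co-split structure: there is a linear map `δ : L → L ⊗ L` which is a Lie
coalgebra structure (antisymmetric and co-Jacobi) and satisfies `[·,·] ∘ δ = id_L`. -/
theorem statement17
    (L : Type*) [LieRing L] [LieAlgebra ℂ L] [FiniteDimensional ℂ L]
    [LieAlgebra.IsSimple ℂ L] :
    ∃ δ : L →ₗ[ℂ] L ⊗[ℂ] L,
      (∀ x : L, tauL ℂ L (δ x) + δ x = 0) ∧
      (∀ x : L,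
        ((LinearMap.id + xiL ℂ L + xiL ℂ L ∘ₗ xiL ℂ L :
            L ⊗[ℂ] (L ⊗[ℂ] L) →ₗ[ℂ] L ⊗[ℂ] (L ⊗[ℂ] L)))
          ((LinearMap.lTensor L δ) (δ x)) = 0) ∧
      (∀ x : L, TensorProduct.lift (brBilin ℂ L) (δ x) = x) := by
  classical
  have hB := LieAlgebra.IsKilling.killingForm_nondegenerate ℂ L
  let b := Module.finBasis ℂ L
  choose c hc using exists_coord_eq_of_nondegenerate hB b
  have hδ := tensorDual_casimirCobracket b hc
  refine ⟨casimirCobracket b c, fun x => ?_, fun x => ?_, lift_brBilin_casimirCobracket b hc⟩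
  · refine eq_zero_of_tensorDual_eq_zero hB fun y z => ?_
    rw [map_add, tensorDual_tauL, hδ, hδ, ← lie_skew y z, map_neg, LinearMap.neg_apply, neg_neg,
      neg_add_cancel]
  · refine eq_zero_of_tensorDual_tensorDual_eq_zero hB fun u v w => ?_
    have key (u v w : L) : tensorDual (killingForm ℂ L u)
        (tensorDual (killingForm ℂ L v) (killingForm ℂ L w))
        (LinearMap.lTensor L (casimirCobracket b c) (casimirCobracket b c x)) =
        killingForm ℂ L ⁅u, ⁅v, w⁆⁆ x := by
      rw [tensorDual_lTensor (p := killingForm ℂ L (-⁅v, w⁆))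
        (fun x => by rw [hδ, map_neg, LinearMap.neg_apply]), hδ, lie_neg, map_neg,
        LinearMap.neg_apply, neg_neg]
    simp only [LinearMap.add_apply, LinearMap.id_apply, LinearMap.comp_apply, map_add,
      tensorDual_xiL, key]
    rw [← LinearMap.add_apply, ← LinearMap.add_apply, ← map_add, ← map_add,
      add_right_comm, lie_jacobi, map_zero, LinearMap.zero_apply]
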